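/- arXiv:2507.18211 — 2 statements merged into one kernel-verified Lean document; each statement's English description precedes it below -/
import Mathlib

section
/- Let −2 < γ ≤ 1 and let G : ℝ³ × ℝ³ → ℝ be a measurable function for which there exist constants C₀ > 0 and α₁, α₂, α₃ > 0 such that |G(v, v_*)| ≤ C₀ w_γ(|v − v_*|) (1 + |v|)^{1−γ} |v − v_*|^{−1} (1 + |v| + |v_*|)^{γ−1} e^{−α₁ |v − v_*|²} e^{−α₃ ((v − v_*)·v/|v − v_*| − α₂ |v − v_*|)²} for all v ≠ v_*. Then there exists a constant C > 0, depending only on γ, C₀, α₁, α₂ and α₃, such that ∫_{ℝ³} |G(v, v_*)| dv_* ≤ C (1 + |v|)^{−1} for all v ∈ ℝ³, and ∫_{ℝ³} |G(v, v_*)| (1 + |v|)^{γ−1} dv ≤ C (1 + |v_*|)^{γ−1} for all v_* ∈ ℝ³. -/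
open MeasureTheory Real Set
open scoped ENNReal RealInnerProductSpace

noncomputable section

/-- `ℝ³` as a Euclidean space. -/
abbrev E3 : Type := EuclideanSpace ℝ (Fin 3)

/-- The singular weight `w_γ`. -/
def wGamma (γ r : ℝ) : ℝ :=
  if -1 < γ then 1 / r
  else if γ = -1 then (|Real.log r| + 1) / r
  else 1 / r ^ |γ|

/-- Coordinates on `ℝ³` split as `ℝ × (ℝ × ℝ)` preserve volume. -/
theorem measurePreserving_coords :
    MeasurePreserving (fun u : E3 => ((u 0, (u 1, u 2)) : ℝ × ℝ × ℝ)) volume volume := by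
  have h1 := PiLp.volume_preserving_ofLp (Fin 3)
  have h2 := volume_preserving_piFinSuccAbove (fun _ : Fin 3 => ℝ) 0
  have h3 := (MeasurePreserving.id (volume : Measure ℝ)).prod (volume_preserving_finTwoArrow ℝ)
  exact h3.comp (h2.comp h1)

/-- Substitution `r = √(x² + ρ²)` in a radial planar integral. -/
theorem lintegral_Ioi_sqrt_sq_add_sq (x : ℝ) (g : ℝ → ℝ≥0∞) :
    ∫⁻ ρ in Ioi (0 : ℝ), ENNReal.ofReal ρ * g √(x ^ 2 + ρ ^ 2) =
      ∫⁻ r in Ioi |x|, ENNReal.ofReal r * g r := by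
  have pos : ∀ r ∈ Ioi |x|, 0 < r ^ 2 - x ^ 2 := by
    intro r hr
    have := sq_lt_sq' (by linarith [abs_nonneg x, mem_Ioi.1 hr]) (mem_Ioi.1 hr)
    rw [sq_abs] at this
    linarith
  have rpos : ∀ r ∈ Ioi |x|, 0 < r := fun r hr => (abs_nonneg x).trans_lt hr
  have himg : (fun r : ℝ => √(r ^ 2 - x ^ 2)) '' Ioi |x| = Ioi 0 := by
    ext ρ
    constructor
    · rintro ⟨r, hr, rfl⟩
      exact Real.sqrt_pos.2 (pos r hr)
    · intro hρ
      have hρ' : 0 < ρ := hρ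
      refine ⟨√(x ^ 2 + ρ ^ 2), ?_, ?_⟩
      · rw [mem_Ioi, ← Real.sqrt_sq_eq_abs]
        exact Real.sqrt_lt_sqrt (sq_nonneg x) (by nlinarith)
      · simp only
        rw [Real.sq_sqrt (by positivity), add_sub_cancel_left, Real.sqrt_sq hρ'.le]
  have hder : ∀ r ∈ Ioi |x|, HasDerivWithinAt (fun r : ℝ => √(r ^ 2 - x ^ 2))
      (r / √(r ^ 2 - x ^ 2)) (Ioi |x|) r := by
    intro r hr
    have h := (((hasDerivAt_pow 2 r).sub_const (x ^ 2)).sqrt (pos r hr).ne').hasDerivWithinAt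
      (s := Ioi |x|)
    refine h.congr_deriv ?_
    rw [pow_one, Nat.cast_ofNat, mul_div_mul_left _ _ two_ne_zero]
  have hinj : InjOn (fun r : ℝ => √(r ^ 2 - x ^ 2)) (Ioi |x|) := by
    intro a ha b hb hab
    have h := (Real.sqrt_inj (pos a ha).le (pos b hb).le).1 hab
    exact (pow_left_inj₀ (rpos a ha).le (rpos b hb).le two_ne_zero).1 (by linarith)
  rw [← himg, lintegral_image_eq_lintegral_abs_deriv_mul measurableSet_Ioi hder hinj]
  refine setLIntegral_congr_fun measurableSet_Ioi fun r hr => ?_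
  have hs := Real.sqrt_pos.2 (pos r hr)
  have hr0 := rpos r hr
  rw [Real.sq_sqrt (pos r hr).le, add_sub_cancel, Real.sqrt_sq hr0.le, ← mul_assoc,
    ← ENNReal.ofReal_mul (abs_nonneg _), abs_of_pos (by positivity), div_mul_cancel₀ _ hs.ne']

/-- Polar coordinates for a radial function on the plane. -/
theorem lintegral_radial_plane (g : ℝ → ℝ≥0∞) (hg : Measurable g) :
    ∫⁻ q : ℝ × ℝ, g (q.1 ^ 2 + q.2 ^ 2) =
      ENNReal.ofReal (2 * π) * ∫⁻ ρ in Ioi (0 : ℝ), ENNReal.ofReal ρ * g (ρ ^ 2) := by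
  rw [← lintegral_comp_polarCoord_symm, polarCoord_target, Measure.volume_eq_prod,
    ← Measure.prod_restrict]
  have h : ∀ p : ℝ × ℝ, ENNReal.ofReal p.1 • g ((polarCoord.symm p).1 ^ 2 +
      (polarCoord.symm p).2 ^ 2) = (ENNReal.ofReal p.1 * g (p.1 ^ 2)) * (fun _ => 1) p.2 := by
    intro p
    simp only [polarCoord_symm_apply, smul_eq_mul, mul_one]
    congr 2
    linear_combination p.1 ^ 2 * Real.sin_sq_add_cos_sq p.2
  simp_rw [h]
  rw [lintegral_prod_mul (f := fun ρ => ENNReal.ofReal ρ * g (ρ ^ 2)) (g := fun _ => 1)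
    (by fun_prop) (by fun_prop), lintegral_const, one_mul, Measure.restrict_apply_univ,
    Real.volume_Ioo, mul_comm]
  congr 2
  ring

/-- Integration over `ℝ³` of a function of the radius and of one coordinate. -/
theorem lintegral_norm_coord (H : ℝ → ℝ → ℝ≥0∞) (hH : Measurable (Function.uncurry H)) :
    ∫⁻ u : E3, H ‖u‖ (u 0) =
      ENNReal.ofReal (2 * π) *
        ∫⁻ r in Ioi (0 : ℝ), ENNReal.ofReal r * ∫⁻ x in Ioo (-r) r, H r x := by
  have hm : Measurable fun p : ℝ × ℝ × ℝ => H √(p.1 ^ 2 + (p.2.1 ^ 2 + p.2.2 ^ 2)) p.1 :=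
    hH.comp (f := fun p : ℝ × ℝ × ℝ => (√(p.1 ^ 2 + (p.2.1 ^ 2 + p.2.2 ^ 2)), p.1)) (by fun_prop)
  have hslice : ∀ x, Measurable fun r => H r x := fun x =>
    hH.comp (f := fun r : ℝ => (r, x)) (by fun_prop)
  have hslice' : ∀ r, Measurable fun x => H r x := fun r =>
    hH.comp (f := fun x : ℝ => (r, x)) (by fun_prop)
  have h1 : ∫⁻ u : E3, H ‖u‖ (u 0) =
      ∫⁻ p : ℝ × ℝ × ℝ, H √(p.1 ^ 2 + (p.2.1 ^ 2 + p.2.2 ^ 2)) p.1 := by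
    rw [← measurePreserving_coords.lintegral_comp hm]
    refine lintegral_congr fun u => ?_
    simp [EuclideanSpace.norm_eq, Fin.sum_univ_three, add_assoc]
  have h2 : ∀ x : ℝ, ∫⁻ q : ℝ × ℝ, H √(x ^ 2 + (q.1 ^ 2 + q.2 ^ 2)) x =
      ENNReal.ofReal (2 * π) * ∫⁻ r in Ioi |x|, ENNReal.ofReal r * H r x := by
    intro x
    rw [lintegral_radial_plane (fun t => H √(x ^ 2 + t) x)
      ((hslice x).comp (f := fun t : ℝ => √(x ^ 2 + t)) (by fun_prop)),
      lintegral_Ioi_sqrt_sq_add_sq x (fun r => H r x)]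
  have hset : MeasurableSet {p : ℝ × ℝ | |p.1| < p.2} :=
    measurableSet_lt (by fun_prop) (by fun_prop)
  have hind : Measurable (Function.uncurry fun x r : ℝ =>
      {p : ℝ × ℝ | |p.1| < p.2}.indicator (fun p => ENNReal.ofReal p.2 * H p.2 p.1) (x, r)) := by
    refine Measurable.indicator ?_ hset
    exact (by fun_prop : Measurable fun p : ℝ × ℝ => ENNReal.ofReal p.2).mul
      (hH.comp (f := fun p : ℝ × ℝ => (p.2, p.1)) (by fun_prop))
  have h3 : ∀ x : ℝ, ∫⁻ r in Ioi |x|, ENNReal.ofReal r * H r x = ∫⁻ r,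
      {p : ℝ × ℝ | |p.1| < p.2}.indicator (fun p => ENNReal.ofReal p.2 * H p.2 p.1) (x, r) := by
    intro x
    rw [← lintegral_indicator measurableSet_Ioi]
    rfl
  have h4 : ∀ r : ℝ, ∫⁻ x,
      {p : ℝ × ℝ | |p.1| < p.2}.indicator (fun p => ENNReal.ofReal p.2 * H p.2 p.1) (x, r) =
      (Ioi (0 : ℝ)).indicator
        (fun r => ENNReal.ofReal r * ∫⁻ x in Ioo (-r) r, H r x) r := by
    intro r
    by_cases hr : r ∈ Ioi (0 : ℝ)
    · rw [indicator_of_mem hr, ← lintegral_const_mul _ (hslice' r),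
        ← lintegral_indicator measurableSet_Ioo]
      refine lintegral_congr fun x => ?_
      simp only [indicator, mem_ofPred_eq, mem_Ioo, abs_lt]
    · rw [indicator_of_notMem hr, lintegral_eq_zero_iff' (by
        exact (hind.comp (f := fun x : ℝ => (x, r)) (by fun_prop)).aemeasurable)]
      refine Filter.Eventually.of_forall fun x => ?_
      refine indicator_of_notMem ?_ _
      simp only [mem_ofPred_eq, not_lt]
      exact (not_lt.1 hr).trans (abs_nonneg x)
  have hint : Measurable fun x : ℝ => ∫⁻ r in Ioi |x|, ENNReal.ofReal r * H r x := by
    simp_rw [h3]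
    exact Measurable.lintegral_prod_right' hind
  rw [h1, Measure.volume_eq_prod, lintegral_prod _ hm.aemeasurable]
  simp only [h2]
  rw [lintegral_const_mul _ hint]
  simp_rw [h3]
  rw [lintegral_lintegral_swap hind.aemeasurable]
  simp_rw [h4]
  rw [lintegral_indicator measurableSet_Ioi]

/-- Rotational invariance: the direction `v` may be replaced by the first coordinate axis. -/
theorem lintegral_norm_inner (H : ℝ → ℝ → ℝ≥0∞) (v : E3) :
    ∫⁻ u : E3, H ‖u‖ ⟪u, v⟫ = ∫⁻ u : E3, H ‖u‖ (‖v‖ * u 0) := by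
  let w : E3 := EuclideanSpace.single 0 ‖v‖
  have hw : ‖v‖ = ‖w‖ := by simp [w]
  let R := (ℝ ∙ (v - w))ᗮ.reflection
  have hR : R v = w := Submodule.reflection_sub hw
  rw [← R.measurePreserving.lintegral_comp_emb R.toHomeomorph.measurableEmbedding
    (fun u => H ‖u‖ (‖v‖ * u 0))]
  refine lintegral_congr fun u => ?_
  rw [R.norm_map, ← R.inner_map_map u v, hR]
  simp [w, EuclideanSpace.inner_single_right]

theorem lintegral_exp_neg_mul_sq_sub {a : ℝ} (ha : 0 < a) {s : ℝ} (hs : 0 < s) (c : ℝ) :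
    ∫⁻ x : ℝ, ENNReal.ofReal (Real.exp (-a * (s * x - c) ^ 2)) =
      ENNReal.ofReal (√(π / a) / s) := by
  have h : ∀ x : ℝ, Real.exp (-a * (s * x - c) ^ 2) =
      Real.exp (-(a * s ^ 2) * (x - c / s) ^ 2) := by
    intro x
    congr 1
    field_simp
  have hb : 0 < a * s ^ 2 := by positivity
  simp_rw [h]
  rw [← ofReal_integral_eq_lintegral_ofReal ((integrable_exp_neg_mul_sq hb).comp_sub_right (c / s))
    (Filter.Eventually.of_forall fun x => (Real.exp_pos _).le),
    integral_sub_right_eq_self (fun x : ℝ => Real.exp (-(a * s ^ 2) * x ^ 2)),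
    integral_gaussian, ← div_div, Real.sqrt_div (by positivity), Real.sqrt_sq hs.le]

theorem wGamma_nonneg (γ : ℝ) {r : ℝ} (hr : 0 ≤ r) : 0 ≤ wGamma γ r := by
  unfold wGamma
  split_ifs <;> positivity

@[fun_prop]
theorem measurable_wGamma (γ : ℝ) : Measurable (wGamma γ) := by
  unfold wGamma
  split_ifs <;> fun_prop

theorem exists_mul_wGamma_le {γ : ℝ} (hγ : -2 < γ) :
    ∃ s > (-1 : ℝ), ∀ r > (0 : ℝ), r * wGamma γ r ≤ 2 * r ^ s + r ^ (1 : ℝ) + r ^ (0 : ℝ) := by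
  have key : ∀ s r : ℝ, 0 < r → 0 < r ^ s := fun s r hr => Real.rpow_pos_of_pos hr s
  unfold wGamma
  split_ifs with h1 h2
  · refine ⟨0, by norm_num, fun r hr => ?_⟩
    rw [mul_one_div_cancel hr.ne', Real.rpow_zero, Real.rpow_one]
    linarith
  · refine ⟨-(1 / 2), by norm_num, fun r hr => ?_⟩
    rw [mul_div_cancel₀ _ hr.ne', Real.rpow_zero, Real.rpow_one]
    rcases le_total r 1 with hr1 | hr1
    · have h := Real.abs_log_mul_self_rpow_lt r (1 / 2) hr hr1 (by norm_num)
      have hp := key (1 / 2) r hr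
      rw [abs_mul, abs_of_pos hp] at h
      rw [Real.rpow_neg hr.le, ← div_eq_mul_inv]
      have : |Real.log r| ≤ 2 / r ^ (1 / 2 : ℝ) := by
        rw [le_div_iff₀ hp]
        linarith
      linarith
    · rw [abs_of_nonneg (Real.log_nonneg hr1)]
      have := Real.log_le_sub_one_of_pos hr
      linarith [key (-(1 / 2)) r hr]
  · have hγ' : |γ| < 2 := abs_lt.2 ⟨hγ, by linarith⟩
    refine ⟨1 - |γ|, by linarith, fun r hr => ?_⟩
    rw [Real.rpow_sub hr, Real.rpow_one, Real.rpow_zero, mul_one_div]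
    have := div_pos hr (key |γ| r hr)
    linarith

theorem exists_lintegral_mul_wGamma {γ a : ℝ} (hγ : -2 < γ) (ha : 0 < a) :
    ∃ M ≥ (0 : ℝ), ∫⁻ r in Ioi (0 : ℝ),
      ENNReal.ofReal (r * wGamma γ r * Real.exp (-a * r ^ 2)) = ENNReal.ofReal M := by
  obtain ⟨s, hs, hle⟩ := exists_mul_wGamma_le hγ
  have hint : IntegrableOn (fun r : ℝ => (2 * r ^ s + r ^ (1 : ℝ) + r ^ (0 : ℝ)) *
      Real.exp (-a * r ^ 2)) (Ioi 0) := by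
    have h := (((integrableOn_rpow_mul_exp_neg_mul_sq ha hs).const_mul 2).add
      (integrableOn_rpow_mul_exp_neg_mul_sq ha (s := 1) (by norm_num))).add
      (integrableOn_rpow_mul_exp_neg_mul_sq ha (s := 0) (by norm_num))
    refine IntegrableOn.congr_fun h (fun r _ => ?_) measurableSet_Ioi
    simp only [Pi.add_apply]
    ring
  have hfin : ∫⁻ r in Ioi (0 : ℝ),
      ENNReal.ofReal (r * wGamma γ r * Real.exp (-a * r ^ 2)) ≠ ∞ := by
    refine ne_top_of_le_ne_top hint.lintegral_lt_top.ne
      (setLIntegral_mono' measurableSet_Ioi fun r hr => ?_)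
    exact ENNReal.ofReal_le_ofReal
      (mul_le_mul_of_nonneg_right (hle r hr) (Real.exp_pos _).le)
  exact ⟨_, ENNReal.toReal_nonneg, (ENNReal.ofReal_toReal hfin).symm⟩

/-- The isotropic majorant of the kernel. -/
def radialKernel (γ a r : ℝ) : ℝ := wGamma γ r * r⁻¹ * Real.exp (-a * r ^ 2)

theorem radialKernel_nonneg (γ a : ℝ) {r : ℝ} (hr : 0 ≤ r) : 0 ≤ radialKernel γ a r := by
  have := wGamma_nonneg γ hr
  unfold radialKernel
  positivity

@[fun_prop]
theorem measurable_radialKernel (γ a : ℝ) : Measurable (radialKernel γ a) := by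
  unfold radialKernel
  fun_prop

theorem sq_mul_radialKernel (γ a : ℝ) {r : ℝ} (hr : 0 < r) :
    r ^ 2 * radialKernel γ a r = r * wGamma γ r * Real.exp (-a * r ^ 2) := by
  unfold radialKernel
  field_simp

theorem lintegral_radialKernel {γ a M : ℝ} (hM : ∫⁻ r in Ioi (0 : ℝ),
    ENNReal.ofReal (r * wGamma γ r * Real.exp (-a * r ^ 2)) = ENNReal.ofReal M) :
    ∫⁻ u : E3, ENNReal.ofReal (radialKernel γ a ‖u‖) = ENNReal.ofReal (4 * π * M) := by
  rw [lintegral_norm_coord (fun r _ => ENNReal.ofReal (radialKernel γ a r))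
    (by simp only [Function.uncurry_def]; fun_prop)]
  have h : ∀ r ∈ Ioi (0 : ℝ), ENNReal.ofReal r * ∫⁻ _ in Ioo (-r) r,
      ENNReal.ofReal (radialKernel γ a r) = ENNReal.ofReal 2 *
        ENNReal.ofReal (r * wGamma γ r * Real.exp (-a * r ^ 2)) := by
    intro r hr
    have hr0 : 0 < r := hr
    rw [lintegral_const, Measure.restrict_apply_univ, Real.volume_Ioo,
      ← ENNReal.ofReal_mul (radialKernel_nonneg γ a hr0.le), ← ENNReal.ofReal_mul hr0.le,
      ← ENNReal.ofReal_mul zero_le_two, ← sq_mul_radialKernel γ a hr0]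
    congr 1
    ring
  rw [setLIntegral_congr_fun measurableSet_Ioi h, lintegral_const_mul _ (by fun_prop), hM,
    ← ENNReal.ofReal_mul zero_le_two, ← ENNReal.ofReal_mul (by positivity)]
  congr 1
  ring

theorem lintegral_anisotropic_le {γ a b c M : ℝ} (hb : 0 < b) (hM : ∫⁻ r in Ioi (0 : ℝ),
    ENNReal.ofReal (r * wGamma γ r * Real.exp (-a * r ^ 2)) = ENNReal.ofReal M)
    {v : E3} (hv : v ≠ 0) :
    ∫⁻ u : E3, ENNReal.ofReal (radialKernel γ a ‖u‖ *
      Real.exp (-b * (⟪u, v⟫ / ‖u‖ - c * ‖u‖) ^ 2)) ≤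
      ENNReal.ofReal (2 * π * (√(π / b) / ‖v‖ * M)) := by
  have hv0 : 0 < ‖v‖ := norm_pos_iff.2 hv
  rw [lintegral_norm_inner (fun r t => ENNReal.ofReal (radialKernel γ a r *
    Real.exp (-b * (t / r - c * r) ^ 2))) v,
    lintegral_norm_coord (fun r x => ENNReal.ofReal (radialKernel γ a r *
      Real.exp (-b * (‖v‖ * x / r - c * r) ^ 2)))
      (by simp only [Function.uncurry_def]; fun_prop),
    ENNReal.ofReal_mul (p := 2 * π) (by positivity)]
  gcongr
  have h : ∀ r ∈ Ioi (0 : ℝ), ENNReal.ofReal r * ∫⁻ x in Ioo (-r) r,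
      ENNReal.ofReal (radialKernel γ a r * Real.exp (-b * (‖v‖ * x / r - c * r) ^ 2)) ≤
      ENNReal.ofReal (√(π / b) / ‖v‖) *
        ENNReal.ofReal (r * wGamma γ r * Real.exp (-a * r ^ 2)) := by
    intro r hr
    have hr0 : 0 < r := hr
    have hk := radialKernel_nonneg γ a hr0.le
    calc _ ≤ ENNReal.ofReal r * ∫⁻ x, ENNReal.ofReal (radialKernel γ a r *
          Real.exp (-b * (‖v‖ / r * x - c * r) ^ 2)) := by
          refine mul_le_mul' le_rfl ?_
          refine (setLIntegral_le_lintegral _ _).trans_eq (lintegral_congr fun x => ?_)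
          rw [div_mul_eq_mul_div]
      _ = ENNReal.ofReal r * (ENNReal.ofReal (radialKernel γ a r) *
          ENNReal.ofReal (√(π / b) / (‖v‖ / r))) := by
          simp_rw [ENNReal.ofReal_mul hk]
          rw [lintegral_const_mul _ (by fun_prop),
            lintegral_exp_neg_mul_sq_sub hb (div_pos hv0 hr0)]
      _ = _ := by
          rw [← ENNReal.ofReal_mul hk, ← ENNReal.ofReal_mul hr0.le,
            ← ENNReal.ofReal_mul (by positivity), ← sq_mul_radialKernel γ a hr0]
          congr 1
          field_simp
  refine (setLIntegral_mono' measurableSet_Ioi h).trans_eq ?_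
  rw [lintegral_const_mul _ (by fun_prop), hM, ← ENNReal.ofReal_mul (by positivity)]

theorem weight_ratio_le_one {γ : ℝ} (hγ : γ ≤ 1) {s t : ℝ} (hs : 0 ≤ s) (ht : 0 ≤ t) :
    (1 + s) ^ (1 - γ) * (1 + s + t) ^ (γ - 1) ≤ 1 := by
  have hs1 : 0 < 1 + s := by linarith
  calc (1 + s) ^ (1 - γ) * (1 + s + t) ^ (γ - 1)
      ≤ (1 + s) ^ (1 - γ) * (1 + s) ^ (γ - 1) :=
        mul_le_mul_of_nonneg_left
          (Real.rpow_le_rpow_of_nonpos hs1 (by linarith) (by linarith)) (by positivity)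
    _ = 1 := by rw [← Real.rpow_add hs1]; simp

theorem weight_cancel_le {γ : ℝ} (hγ : γ ≤ 1) {s t : ℝ} (hs : 0 ≤ s) (ht : 0 ≤ t) :
    (1 + s) ^ (1 - γ) * (1 + s + t) ^ (γ - 1) * (1 + s) ^ (γ - 1) ≤ (1 + t) ^ (γ - 1) := by
  have hs1 : 0 < 1 + s := by linarith
  have h : (1 + s) ^ (1 - γ) * (1 + s) ^ (γ - 1) = 1 := by
    rw [← Real.rpow_add hs1]; simp
  rw [mul_right_comm, h, one_mul]
  exact Real.rpow_le_rpow_of_nonpos (by linarith) (by linarith) (by linarith)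

theorem lintegral_anisotropic_le_inv {γ a b c M : ℝ} (hb : 0 < b) (hM0 : 0 ≤ M)
    (hM : ∫⁻ r in Ioi (0 : ℝ),
      ENNReal.ofReal (r * wGamma γ r * Real.exp (-a * r ^ 2)) = ENNReal.ofReal M) (v : E3) :
    ∫⁻ u : E3, ENNReal.ofReal (radialKernel γ a ‖u‖ *
      Real.exp (-b * (⟪u, v⟫ / ‖u‖ - c * ‖u‖) ^ 2)) ≤
      ENNReal.ofReal ((8 * π * M + 4 * π * √(π / b) * M) * (1 + ‖v‖)⁻¹) := by
  have hA : 0 ≤ π * M := by positivity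
  have hB : 0 ≤ π * √(π / b) * M := by positivity
  rcases le_total ‖v‖ 1 with hv | hv
  · calc _ ≤ ∫⁻ u : E3, ENNReal.ofReal (radialKernel γ a ‖u‖) := by
          refine lintegral_mono fun u => ENNReal.ofReal_le_ofReal ?_
          refine mul_le_of_le_one_right (radialKernel_nonneg γ a (norm_nonneg u)) ?_
          rw [Real.exp_le_one_iff, neg_mul]
          exact neg_nonpos.2 (by positivity)
      _ = ENNReal.ofReal (4 * π * M) := lintegral_radialKernel hM
      _ ≤ _ := by
          refine ENNReal.ofReal_le_ofReal ?_
          rw [← div_eq_mul_inv, le_div_iff₀ (by positivity)]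
          nlinarith [mul_le_mul_of_nonneg_left hv hA]
  · have hv0 : 0 < ‖v‖ := by linarith
    refine (lintegral_anisotropic_le hb hM (norm_pos_iff.1 hv0)).trans
      (ENNReal.ofReal_le_ofReal ?_)
    have h : 2 * π * (√(π / b) / ‖v‖ * M) = 2 * (π * √(π / b) * M) / ‖v‖ := by ring
    rw [h, ← div_eq_mul_inv, div_le_div_iff₀ hv0 (by positivity)]
    nlinarith [mul_le_mul_of_nonneg_left hv hB, mul_nonneg hA hv0.le]

/-- For `−2 < γ ≤ 1` and `G` satisfying the gradient-type pointwise bound,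
`∫ |G(v,·)| ≤ C (1+|v|)⁻¹` and `∫ |G(·,v_*)| (1+|·|)^{γ−1} ≤ C (1+|v_*|)^{γ−1}`. -/
theorem gradient_kernel_decay_bounds (γ C₀ α₁ α₂ α₃ : ℝ) (hγl : -2 < γ) (hγu : γ ≤ 1)
    (hC₀ : 0 < C₀) (hα₁ : 0 < α₁) (hα₂ : 0 < α₂) (hα₃ : 0 < α₃) :
    ∃ C > (0 : ℝ), ∀ G : E3 → E3 → ℝ, Measurable (Function.uncurry G) →
      (∀ v vs : E3, v ≠ vs →
        |G v vs| ≤ C₀ * wGamma γ ‖v - vs‖ * (1 + ‖v‖) ^ (1 - γ) * ‖v - vs‖⁻¹ *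
          (1 + ‖v‖ + ‖vs‖) ^ (γ - 1) * Real.exp (-α₁ * ‖v - vs‖ ^ 2) *
          Real.exp (-α₃ * (⟪v - vs, v⟫ / ‖v - vs‖ - α₂ * ‖v - vs‖) ^ 2)) →
      (∀ v : E3,
        ∫⁻ vs : E3, ENNReal.ofReal |G v vs| ≤ ENNReal.ofReal (C * (1 + ‖v‖)⁻¹)) ∧
      (∀ vs : E3,
        ∫⁻ v : E3, ENNReal.ofReal (|G v vs| * (1 + ‖v‖) ^ (γ - 1)) ≤
          ENNReal.ofReal (C * (1 + ‖vs‖) ^ (γ - 1))) := by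
  obtain ⟨M, hM0, hM⟩ := exists_lintegral_mul_wGamma hγl hα₁
  have hne : ∀ w : E3, ∀ᵐ u : E3, u ≠ w := fun w => by simp [ae_iff]
  refine ⟨C₀ * (8 * π * M + 4 * π * √(π / α₃) * M) + 1, by positivity, fun G _ hG => ?_⟩
  have hk : ∀ v vs : E3, 0 ≤ radialKernel γ α₁ ‖v - vs‖ :=
    fun v vs => radialKernel_nonneg γ α₁ (norm_nonneg _)
  have hG' : ∀ v vs : E3, v ≠ vs → |G v vs| ≤ C₀ * (radialKernel γ α₁ ‖v - vs‖ *
      Real.exp (-α₃ * (⟪v - vs, v⟫ / ‖v - vs‖ - α₂ * ‖v - vs‖) ^ 2)) *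
      ((1 + ‖v‖) ^ (1 - γ) * (1 + ‖v‖ + ‖vs‖) ^ (γ - 1)) := by
    intro v vs h
    refine (hG v vs h).trans_eq ?_
    unfold radialKernel
    ring
  refine ⟨fun v => ?_, fun vs => ?_⟩
  · calc ∫⁻ vs : E3, ENNReal.ofReal |G v vs|
        ≤ ∫⁻ vs : E3, ENNReal.ofReal C₀ * ENNReal.ofReal (radialKernel γ α₁ ‖v - vs‖ *
          Real.exp (-α₃ * (⟪v - vs, v⟫ / ‖v - vs‖ - α₂ * ‖v - vs‖) ^ 2)) := by
          refine lintegral_mono_ae ?_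
          filter_upwards [hne v] with vs hvs
          rw [← ENNReal.ofReal_mul hC₀.le]
          refine ENNReal.ofReal_le_ofReal ((hG' v vs hvs.symm).trans ?_)
          exact mul_le_of_le_one_right
            (mul_nonneg hC₀.le (mul_nonneg (hk v vs) (Real.exp_pos _).le))
            (weight_ratio_le_one hγu (norm_nonneg v) (norm_nonneg vs))
      _ = ENNReal.ofReal C₀ * ∫⁻ u : E3, ENNReal.ofReal (radialKernel γ α₁ ‖u‖ *
          Real.exp (-α₃ * (⟪u, v⟫ / ‖u‖ - α₂ * ‖u‖) ^ 2)) := by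
          rw [lintegral_const_mul' _ _ ENNReal.ofReal_ne_top,
            lintegral_sub_left_eq_self (fun u : E3 => ENNReal.ofReal (radialKernel γ α₁ ‖u‖ *
              Real.exp (-α₃ * (⟪u, v⟫ / ‖u‖ - α₂ * ‖u‖) ^ 2))) v]
      _ ≤ ENNReal.ofReal C₀ * ENNReal.ofReal
          ((8 * π * M + 4 * π * √(π / α₃) * M) * (1 + ‖v‖)⁻¹) := by
          gcongr
          exact lintegral_anisotropic_le_inv hα₃ hM0 hM v
      _ ≤ _ := by
          rw [← ENNReal.ofReal_mul hC₀.le, ← mul_assoc]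
          gcongr
          linarith
  · calc ∫⁻ v : E3, ENNReal.ofReal (|G v vs| * (1 + ‖v‖) ^ (γ - 1))
        ≤ ∫⁻ v : E3, ENNReal.ofReal (C₀ * (1 + ‖vs‖) ^ (γ - 1)) *
          ENNReal.ofReal (radialKernel γ α₁ ‖v - vs‖) := by
          refine lintegral_mono_ae ?_
          filter_upwards [hne vs] with v hv
          rw [← ENNReal.ofReal_mul (by positivity)]
          refine ENNReal.ofReal_le_ofReal ?_
          have hexp : Real.exp (-α₃ * (⟪v - vs, v⟫ / ‖v - vs‖ - α₂ * ‖v - vs‖) ^ 2) ≤ 1 := by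
            rw [Real.exp_le_one_iff, neg_mul]
            exact neg_nonpos.2 (by positivity)
          have hkv := hk v vs
          calc |G v vs| * (1 + ‖v‖) ^ (γ - 1)
              ≤ C₀ * (radialKernel γ α₁ ‖v - vs‖ *
                Real.exp (-α₃ * (⟪v - vs, v⟫ / ‖v - vs‖ - α₂ * ‖v - vs‖) ^ 2)) *
                ((1 + ‖v‖) ^ (1 - γ) * (1 + ‖v‖ + ‖vs‖) ^ (γ - 1)) * (1 + ‖v‖) ^ (γ - 1) :=
                mul_le_mul_of_nonneg_right (hG' v vs hv) (by positivity)
            _ ≤ C₀ * (radialKernel γ α₁ ‖v - vs‖ * 1) * (1 + ‖vs‖) ^ (γ - 1) := by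
                rw [mul_assoc _ (_ * _) (_ ^ (γ - 1))]
                exact mul_le_mul (by gcongr)
                  (weight_cancel_le hγu (norm_nonneg v) (norm_nonneg vs))
                  (by positivity) (by positivity)
            _ = _ := by ring
      _ = ENNReal.ofReal (C₀ * (1 + ‖vs‖) ^ (γ - 1)) * ENNReal.ofReal (4 * π * M) := by
          rw [lintegral_const_mul' _ _ ENNReal.ofReal_ne_top,
            lintegral_sub_right_eq_self
              (fun u : E3 => ENNReal.ofReal (radialKernel γ α₁ ‖u‖)) vs,
            lintegral_radialKernel hM]
      _ ≤ _ := by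
          rw [← ENNReal.ofReal_mul (by positivity), mul_right_comm]
          gcongr
          have h1 : 0 ≤ C₀ * (π * M) := by positivity
          have h2 : 0 ≤ C₀ * (π * √(π / α₃) * M) := by positivity
          linarith
end
end

section
/- Let −3 < γ ≤ 1 and let k* : ℝ³ × ℝ³ → ℝ be a measurable kernel for which there exist constants C₀ > 0 and α₁ > 0 such that |k*(v, v_*)| ≤ C₀ w_γ(|v − v_*|) (1 + |v| + |v_*|)^{γ−1} (1 + |v|)^{−γ} e^{−α₁ |v − v_*|²} for all v ≠ v_*. Then there exists a constant C > 0, depending only on γ, C₀ and α₁, such that for every measurable h : ℝ³ → ℝ, ∫_{ℝ³} (∫_{ℝ³} |k*(v, v_*)| |h(v_*)| dv_*)² (1 + |v|)^γ dv ≤ C ∫_{ℝ³} h(v)² (1 + |v|)^γ dv. -/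
open MeasureTheory Real Set
open scoped ENNReal

noncomputable section

/-- An integrable radial majorant of the singular kernel, as a function of the distance. -/
def radialMajorant (γ α r : ℝ) : ℝ :=
  (r ^ (-0 : ℝ) + r ^ (-1 : ℝ) + r ^ (-2 : ℝ) + r ^ (-|γ|)) *
    ((2 + r) ^ 3 * Real.exp (-α * r ^ 2))

lemma measurable_radialMajorant (γ α : ℝ) : Measurable (radialMajorant γ α) := by
  unfold radialMajorant
  fun_prop

lemma radialMajorant_nonneg (γ α : ℝ) {r : ℝ} (hr : 0 ≤ r) : 0 ≤ radialMajorant γ α r := by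
  unfold radialMajorant
  positivity

lemma wGamma_le (γ : ℝ) {r : ℝ} (hr : 0 < r) :
    wGamma γ r ≤ r ^ (-0 : ℝ) + r ^ (-1 : ℝ) + r ^ (-2 : ℝ) + r ^ (-|γ|) := by
  have h0 : 0 ≤ r ^ (-0 : ℝ) := by positivity
  have h1 : 0 ≤ r ^ (-1 : ℝ) := by positivity
  have h2 : 0 ≤ r ^ (-2 : ℝ) := by positivity
  have h3 : 0 ≤ r ^ (-|γ|) := by positivity
  unfold wGamma
  split_ifs
  · have : 1 / r = r ^ (-1 : ℝ) := by rw [rpow_neg_one, one_div]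
    rw [this]
    linarith
  · have e0 : r ^ (-0 : ℝ) = r / r := by rw [neg_zero, rpow_zero, div_self hr.ne']
    have e2 : r ^ (-2 : ℝ) = r⁻¹ / r := by
      rw [rpow_neg hr.le, rpow_two]; field_simp
    have hlog : |Real.log r| + 1 ≤ r + r⁻¹ := by
      have a := Real.log_le_sub_one_of_pos hr
      have b := Real.log_le_sub_one_of_pos (inv_pos.2 hr)
      rw [Real.log_inv] at b
      have c := inv_pos.2 hr
      rcases abs_cases (Real.log r) with h | h <;> linarith
    have : (|Real.log r| + 1) / r ≤ (r + r⁻¹) / r := by gcongr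
    rw [add_div r, ← e0, ← e2] at this
    linarith
  · have : 1 / r ^ |γ| = r ^ (-|γ|) := by rw [rpow_neg hr.le, one_div]
    rw [this]
    linarith

lemma integrableOn_sq_mul_rpow_neg_mul_exp {α p : ℝ} (hα : 0 < α) (hp : p < 3) :
    IntegrableOn (fun r : ℝ ↦ r ^ 2 * (r ^ (-p) * ((2 + r) ^ 3 * Real.exp (-α * r ^ 2))))
      (Ioi 0) := by
  have key (n : ℕ) :
      IntegrableOn (fun r : ℝ ↦ r ^ (2 - p + n) * Real.exp (-α * r ^ 2)) (Ioi 0) :=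
    integrableOn_rpow_mul_exp_neg_mul_sq hα (by have := n.cast_nonneg (α := ℝ); linarith)
  have hsum := ((((key 0).const_mul 8).add ((key 1).const_mul 12)).add
    ((key 2).const_mul 6)).add (key 3)
  refine IntegrableOn.congr_fun hsum (fun r hr ↦ ?_) measurableSet_Ioi
  have hr : 0 < r := hr
  simp only [Pi.add_apply, rpow_add hr, rpow_natCast, sub_eq_add_neg, rpow_two]
  ring

lemma integrableOn_sq_mul_radialMajorant {γ α : ℝ} (hα : 0 < α) (hγ : |γ| < 3) :
    IntegrableOn (fun r : ℝ ↦ r ^ 2 * radialMajorant γ α r) (Ioi 0) := by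
  have hsum := (((integrableOn_sq_mul_rpow_neg_mul_exp (p := 0) hα (by norm_num)).add
    (integrableOn_sq_mul_rpow_neg_mul_exp (p := 1) hα (by norm_num))).add
    (integrableOn_sq_mul_rpow_neg_mul_exp (p := 2) hα (by norm_num))).add
    (integrableOn_sq_mul_rpow_neg_mul_exp hα hγ)
  refine IntegrableOn.congr_fun hsum (fun r _ ↦ ?_) measurableSet_Ioi
  simp only [Pi.add_apply, radialMajorant]
  ring

lemma integrable_radialMajorant_norm {γ α : ℝ} (hα : 0 < α) (hγ : |γ| < 3) :
    Integrable (fun x : E3 ↦ radialMajorant γ α ‖x‖) := by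
  rw [integrable_fun_norm_addHaar volume]
  simpa using integrableOn_sq_mul_radialMajorant hα hγ

/-- Cauchy–Schwarz with respect to a weight `φ`. -/
lemma lintegral_mul_sq_le {X : Type*} [MeasurableSpace X] {μ : Measure X} {φ g : X → ℝ≥0∞}
    (hφ : Measurable φ) (hg : Measurable g) :
    (∫⁻ x, φ x * g x ∂μ) ^ 2 ≤ (∫⁻ x, φ x ∂μ) * ∫⁻ x, φ x * g x ^ 2 ∂μ := by
  have holder := ENNReal.lintegral_mul_le_Lp_mul_Lq μ Real.HolderConjugate.two_two
    (f := fun x ↦ φ x ^ (1 / 2 : ℝ)) (g := fun x ↦ φ x ^ (1 / 2 : ℝ) * g x)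
    (by fun_prop) (by fun_prop)
  have half (a : ℝ≥0∞) : a ^ (1 / 2 : ℝ) * a ^ (1 / 2 : ℝ) = a := by
    rw [← ENNReal.rpow_add_of_nonneg _ _ (by norm_num) (by norm_num)]; norm_num
  have sqrt_sq (a : ℝ≥0∞) : (a ^ (1 / 2 : ℝ)) ^ 2 = a := by rw [sq, half]
  simp only [Pi.mul_apply, ← mul_assoc, half, ENNReal.rpow_two, mul_pow, sqrt_sq] at holder
  calc (∫⁻ x, φ x * g x ∂μ) ^ 2 ≤ _ := pow_le_pow_left' holder 2
    _ = _ := by rw [mul_pow, sqrt_sq, sqrt_sq]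

/-- Young's inequality `‖φ ⋆ g‖₂ ≤ ‖φ‖₁ ‖g‖₂`. -/
lemma lintegral_convolution_sq_le {φ g : E3 → ℝ≥0∞} (hφ : Measurable φ) (hg : Measurable g) :
    ∫⁻ v, (∫⁻ w, φ (v - w) * g w) ^ 2 ≤ (∫⁻ x, φ x) ^ 2 * ∫⁻ w, g w ^ 2 := by
  calc ∫⁻ v, (∫⁻ w, φ (v - w) * g w) ^ 2
      ≤ ∫⁻ v, (∫⁻ x, φ x) * ∫⁻ w, φ (v - w) * g w ^ 2 := by
        refine lintegral_mono fun v ↦ ?_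
        have := lintegral_mul_sq_le (μ := volume) (φ := fun w ↦ φ (v - w)) (by fun_prop) hg
        rwa [lintegral_sub_left_eq_self] at this
    _ = (∫⁻ x, φ x) * ∫⁻ v, ∫⁻ w, φ (v - w) * g w ^ 2 :=
        lintegral_const_mul _ (Measurable.lintegral_prod_right' (f := fun p : E3 × E3 ↦
          φ (p.1 - p.2) * g p.2 ^ 2) (by fun_prop))
    _ = (∫⁻ x, φ x) * ∫⁻ w, ∫⁻ v, φ (v - w) * g w ^ 2 := by
        rw [lintegral_lintegral_swap (by fun_prop)]
    _ = (∫⁻ x, φ x) * ∫⁻ w, (∫⁻ x, φ x) * g w ^ 2 := by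
        congr 1
        refine lintegral_congr fun w ↦ ?_
        rw [lintegral_mul_const _ (by fun_prop), lintegral_sub_right_eq_self]
    _ = (∫⁻ x, φ x) ^ 2 * ∫⁻ w, g w ^ 2 := by
        rw [lintegral_const_mul _ (by fun_prop), ← mul_assoc, sq]

lemma rpow_le_rpow_of_one_le_of_le {x y s t : ℝ} (hx : 1 ≤ x) (hxy : x ≤ y) (hst : |s| ≤ t) :
    x ^ s ≤ y ^ t :=
  (rpow_le_rpow_of_exponent_le hx ((le_abs_self s).trans hst)).trans
    (rpow_le_rpow (by linarith) hxy ((abs_nonneg s).trans hst))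

/-- The polynomial weights are controlled by the distance of the two velocities. -/
lemma weight_le {γ a b r : ℝ} (hγ : |γ| ≤ 3) (ha : 0 ≤ a) (hb : 0 ≤ b)
    (hr : 0 ≤ r) (hab : a ≤ b + r) (hba : b ≤ a + r) :
    (1 + a + b) ^ (γ - 1) * (1 + a) ^ (-γ) * (1 + a) ^ (γ / 2) ≤
      (2 + r) ^ 3 * (1 + b) ^ (γ / 2) := by
  have ratio {a b : ℝ} (ha : 0 ≤ a) (hb : 0 ≤ b) (h : b ≤ a + r) :
      ((1 + a + b) / (1 + a)) ^ (γ / 2) ≤ (2 + r) ^ (3 / 2 : ℝ) := by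
    refine rpow_le_rpow_of_one_le_of_le ?_ ?_ ?_
    · rw [one_le_div (by positivity)]; linarith
    · rw [div_le_iff₀ (by positivity)]; nlinarith
    · rw [abs_div, abs_two]; linarith
  have h₁ := ratio ha hb hba
  have h₂ := ratio hb ha hab
  rw [show 1 + b + a = 1 + a + b by ring] at h₂
  have hsub : (1 + a + b) ^ (γ - 1) ≤ (1 + a + b) ^ γ :=
    rpow_le_rpow_of_exponent_le (by linarith) (by linarith)
  have hcube : (2 + r) ^ (3 / 2 : ℝ) * (2 + r) ^ (3 / 2 : ℝ) = (2 + r) ^ 3 := by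
    rw [← rpow_add (by positivity)]
    norm_num
  have hS : (1 + a + b) ^ γ = (1 + a + b) ^ (γ / 2) * (1 + a + b) ^ (γ / 2) := by
    rw [← rpow_add (by positivity), add_halves]
  have hA : (1 + a) ^ (-γ) * (1 + a) ^ (γ / 2) = ((1 + a) ^ (γ / 2))⁻¹ := by
    rw [← rpow_add (by positivity), ← rpow_neg (by positivity)]; ring_nf
  have hB : 0 < (1 + b) ^ (γ / 2) := by positivity
  calc (1 + a + b) ^ (γ - 1) * (1 + a) ^ (-γ) * (1 + a) ^ (γ / 2)
      ≤ (1 + a + b) ^ γ * ((1 + a) ^ (-γ) * (1 + a) ^ (γ / 2)) := by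
        rw [mul_assoc]; gcongr
    _ = ((1 + a + b) / (1 + a)) ^ (γ / 2) * ((1 + a + b) / (1 + b)) ^ (γ / 2) *
          (1 + b) ^ (γ / 2) := by
        rw [hA, hS, div_rpow (by positivity) (by positivity),
          div_rpow (by positivity) (by positivity)]
        field_simp
    _ ≤ (2 + r) ^ (3 / 2 : ℝ) * (2 + r) ^ (3 / 2 : ℝ) * (1 + b) ^ (γ / 2) := by gcongr
    _ = (2 + r) ^ 3 * (1 + b) ^ (γ / 2) := by rw [hcube]

lemma kernel_bound_mul_weight_le {γ C₀ α : ℝ} (hγ : |γ| ≤ 3) (hC₀ : 0 ≤ C₀) {v w : E3}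
    (hvw : v ≠ w) :
    C₀ * wGamma γ ‖v - w‖ * (1 + ‖v‖ + ‖w‖) ^ (γ - 1) * (1 + ‖v‖) ^ (-γ) *
        Real.exp (-α * ‖v - w‖ ^ 2) * (1 + ‖v‖) ^ (γ / 2) ≤
      C₀ * radialMajorant γ α ‖v - w‖ * (1 + ‖w‖) ^ (γ / 2) := by
  have hr : 0 < ‖v - w‖ := norm_sub_pos_iff.2 hvw
  have hweight := weight_le hγ (norm_nonneg v) (norm_nonneg w) hr.le
    (by linarith [norm_sub_norm_le v w]) (by linarith [norm_sub_norm_le w v, norm_sub_rev v w])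
  have hw := wGamma_le γ hr
  calc _ = C₀ * Real.exp (-α * ‖v - w‖ ^ 2) * (wGamma γ ‖v - w‖ *
          ((1 + ‖v‖ + ‖w‖) ^ (γ - 1) * (1 + ‖v‖) ^ (-γ) * (1 + ‖v‖) ^ (γ / 2))) := by ring
    _ ≤ C₀ * Real.exp (-α * ‖v - w‖ ^ 2) * ((‖v - w‖ ^ (-0 : ℝ) + ‖v - w‖ ^ (-1 : ℝ) +
          ‖v - w‖ ^ (-2 : ℝ) + ‖v - w‖ ^ (-|γ|)) *
          ((2 + ‖v - w‖) ^ 3 * (1 + ‖w‖) ^ (γ / 2))) := by gcongr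
    _ = _ := by unfold radialMajorant; ring

/-- `L²` boundedness on the weighted space `L²_{0,γ/2}(ℝ³)` of the integral operator
with kernel `|k*|`:
`∫ (∫ |k*(v,v_*)||h(v_*)| dv_*)² (1+|v|)^γ dv ≤ C ∫ h² (1+|v|)^γ dv`. -/
theorem kstar_L2_bounded (γ C₀ α₁ : ℝ) (hγl : -3 < γ) (hγu : γ ≤ 1)
    (hC₀ : 0 < C₀) (hα₁ : 0 < α₁) :
    ∃ C > (0 : ℝ), ∀ kstar : E3 → E3 → ℝ, Measurable (Function.uncurry kstar) →
      (∀ v vs : E3, v ≠ vs →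
        |kstar v vs| ≤ C₀ * wGamma γ ‖v - vs‖ * (1 + ‖v‖ + ‖vs‖) ^ (γ - 1) *
          (1 + ‖v‖) ^ (-γ) * Real.exp (-α₁ * ‖v - vs‖ ^ 2)) →
      ∀ h : E3 → ℝ, Measurable h →
        ∫⁻ v : E3, (∫⁻ vs : E3, ENNReal.ofReal (|kstar v vs| * |h vs|)) ^ 2 *
            ENNReal.ofReal ((1 + ‖v‖) ^ γ) ≤
          ENNReal.ofReal C * ∫⁻ v : E3, ENNReal.ofReal (h v ^ 2 * (1 + ‖v‖) ^ γ) := by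
  have hγ : |γ| < 3 := abs_lt.2 ⟨hγl, by linarith⟩
  set φ : E3 → ℝ≥0∞ := fun x ↦ ENNReal.ofReal (C₀ * radialMajorant γ α₁ ‖x‖) with hφ_def
  have hφ : Measurable φ :=
    (((measurable_radialMajorant γ α₁).comp measurable_norm).const_mul C₀).ennreal_ofReal
  have hφ_fin : ∫⁻ x, φ x ≠ ∞ :=
    ((integrable_radialMajorant_norm hα₁ hγ).const_mul C₀).lintegral_lt_top.ne
  refine ⟨(∫⁻ x, φ x).toReal ^ 2 + 1, by positivity, fun k _ hk h hh ↦ ?_⟩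
  set g : E3 → ℝ≥0∞ := fun w ↦ ENNReal.ofReal (|h w| * (1 + ‖w‖) ^ (γ / 2)) with hg_def
  have hg : Measurable g := by fun_prop
  have hsq (v : E3) : ((1 + ‖v‖) ^ (γ / 2)) ^ 2 = (1 + ‖v‖) ^ γ := by
    rw [sq, ← rpow_add (by positivity), add_halves]
  have hg_sq (v : E3) : ENNReal.ofReal (h v ^ 2 * (1 + ‖v‖) ^ γ) = g v ^ 2 := by
    rw [hg_def, ← ENNReal.ofReal_pow (by positivity), mul_pow, sq_abs, hsq]
  have hpoint (v : E3) : (∫⁻ w, ENNReal.ofReal (|k v w| * |h w|)) ^ 2 *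
      ENNReal.ofReal ((1 + ‖v‖) ^ γ) ≤ (∫⁻ w, φ (v - w) * g w) ^ 2 := by
    rw [← hsq, ENNReal.ofReal_pow (by positivity), ← mul_pow]
    refine pow_le_pow_left' ?_ 2
    rw [← lintegral_mul_const' _ _ ENNReal.ofReal_ne_top]
    refine lintegral_mono_ae ?_
    filter_upwards [Measure.ae_ne volume v] with w hw
    have hR := radialMajorant_nonneg γ α₁ (norm_nonneg (v - w))
    rw [hφ_def, hg_def, ← ENNReal.ofReal_mul (by positivity), ← ENNReal.ofReal_mul (by positivity)]
    refine ENNReal.ofReal_le_ofReal ?_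
    calc |k v w| * |h w| * (1 + ‖v‖) ^ (γ / 2)
        = |k v w| * (1 + ‖v‖) ^ (γ / 2) * |h w| := by ring
      _ ≤ C₀ * radialMajorant γ α₁ ‖v - w‖ * (1 + ‖w‖) ^ (γ / 2) * |h w| := by
          refine mul_le_mul_of_nonneg_right ?_ (abs_nonneg _)
          exact (mul_le_mul_of_nonneg_right (hk v w hw.symm) (by positivity)).trans
            (kernel_bound_mul_weight_le hγ.le hC₀.le hw.symm)
      _ = C₀ * radialMajorant γ α₁ ‖v - w‖ * (|h w| * (1 + ‖w‖) ^ (γ / 2)) := by ring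
  simp only [hg_sq]
  calc _ ≤ ∫⁻ v, (∫⁻ w, φ (v - w) * g w) ^ 2 := lintegral_mono hpoint
    _ ≤ (∫⁻ x, φ x) ^ 2 * ∫⁻ w, g w ^ 2 := lintegral_convolution_sq_le hφ hg
    _ ≤ ENNReal.ofReal ((∫⁻ x, φ x).toReal ^ 2 + 1) * ∫⁻ w, g w ^ 2 := by
        gcongr
        rw [ENNReal.ofReal_add (by positivity) zero_le_one, ENNReal.ofReal_pow (by positivity),
          ENNReal.ofReal_toReal hφ_fin]
        exact le_self_add
end
end
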